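/- Let R = ∏_{i∈I} R_i be a direct product of rings over a non-empty index set I, with ℙ(R) identified componentwise with ∏_{i∈I} ℙ(R_i). Then for all p, q ∈ ℙ(R): p ∥ q if and only if p_i ∥ q_i for all i ∈ I. -/

import Mathlib

/-- `p` is a point of the projective line over `R`. -/
def IsPoint (R : Type*) [Ring R] (p : Submodule R (R × R)) : Prop :=
  ∃ g : (Matrix (Fin 2) (Fin 2) R)ˣ,
    p = Submodule.span R {(g.val 0 0, g.val 0 1)}

/-- distant relation -/
def Distant {R : Type*} [Ring R] (p q : Submodule R (R × R)) : Prop :=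
  ∃ g : (Matrix (Fin 2) (Fin 2) R)ˣ,
    p = Submodule.span R {(g.val 0 0, g.val 0 1)} ∧
    q = Submodule.span R {(g.val 1 0, g.val 1 1)}

/-- `△(p)`: the set of points distant to `p`. -/
def DistantSet {R : Type*} [Ring R] (p : Submodule R (R × R)) :
    Set (Submodule R (R × R)) := {x | Distant x p}

/-- `p ∥ q` iff `△(p) ⊆ △(q)`. -/
def Parallel {R : Type*} [Ring R] (p q : Submodule R (R × R)) : Prop :=
  DistantSet p ⊆ DistantSet q

/-- `p ∼ q` via `r`: `r ∦ p`, `r ∦ q` and `△(r) ⊆ △(p) ∪ △(q)`. -/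
def AdjacentVia {R : Type*} [Ring R] (p q r : Submodule R (R × R)) : Prop :=
  ¬ Parallel r p ∧ ¬ Parallel r q ∧ DistantSet r ⊆ DistantSet p ∪ DistantSet q

/-- `p ∼ q`: there is a point `r` with `p ∼ q` via `r`. -/
def Adjacent {R : Type*} [Ring R] (p q : Submodule R (R × R)) : Prop :=
  ∃ r, IsPoint R r ∧ AdjacentVia p q r

/-- The `j`-th component projection `(Π R_i)² → (R j)²`, semilinear over evaluation. -/
def compMap {I : Type*} (R : I → Type*) [∀ i, Ring (R i)] (j : I) :
    ((Π i, R i) × (Π i, R i)) →ₛₗ[Pi.evalRingHom R j] (R j × R j) where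
  toFun x := (x.1 j, x.2 j)
  map_add' _ _ := rfl
  map_smul' _ _ := rfl

instance {I : Type*} (R : I → Type*) [∀ i, Ring (R i)] (j : I) :
    RingHomSurjective (Pi.evalRingHom R j) :=
  ⟨fun x => by classical exact ⟨Pi.single j x, Pi.single_eq_same j x⟩⟩

/-- The `j`-th component of a point of `ℙ(Π R_i)` under the canonical identification of
`ℙ(Π R_i)` with `Π ℙ(R_i)`: the image of `R(a,b)` is `R_j(a_j, b_j)`. -/
def component {I : Type*} {R : I → Type*} [∀ i, Ring (R i)]
    (p : Submodule (Π i, R i) ((Π i, R i) × (Π i, R i))) (j : I) :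
    Submodule (R j) (R j × R j) :=
  Submodule.map (compMap R j) p

theorem component_span_singleton {I : Type*} {R : I → Type*} [∀ i, Ring (R i)]
    (a b : Π i, R i) (j : I) :
    component (Submodule.span (Π i, R i) {(a, b)}) j = Submodule.span (R j) {(a j, b j)} := by
  rw [component, Submodule.map_span, Set.image_singleton]
  rfl

theorem span_singleton_le_of_component_le {I : Type*} {R : I → Type*} [∀ i, Ring (R i)]
    {a b c d : Π i, R i}
    (h : ∀ i, component (Submodule.span (Π i, R i) {(a, b)}) i ≤
      component (Submodule.span (Π i, R i) {(c, d)}) i) :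
    Submodule.span (Π i, R i) {(a, b)} ≤ Submodule.span (Π i, R i) {(c, d)} := by
  simp only [component_span_singleton, Submodule.span_singleton_le_iff_mem,
    Submodule.mem_span_singleton] at h ⊢
  choose r hr using h
  exact ⟨r, Prod.ext (funext fun i => congrArg Prod.fst (hr i))
    (funext fun i => congrArg Prod.snd (hr i))⟩

theorem span_singleton_eq_of_component_eq {I : Type*} {R : I → Type*} [∀ i, Ring (R i)]
    {a b c d : Π i, R i}
    (h : ∀ i, component (Submodule.span (Π i, R i) {(a, b)}) i =
      component (Submodule.span (Π i, R i) {(c, d)}) i) :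
    Submodule.span (Π i, R i) {(a, b)} = Submodule.span (Π i, R i) {(c, d)} :=
  le_antisymm (span_singleton_le_of_component_le fun i => (h i).le)
    (span_singleton_le_of_component_le fun i => (h i).ge)

/-- An invertible matrix over a product of rings, assembled from invertible matrices over the
factors. -/
def piMatrixUnit {I : Type*} {R : I → Type*} [∀ i, Ring (R i)]
    (G : ∀ i, (Matrix (Fin 2) (Fin 2) (R i))ˣ) : (Matrix (Fin 2) (Fin 2) (Π i, R i))ˣ where
  val := Matrix.of fun k l i => (G i).val k l
  inv := Matrix.of fun k l i => (G i).inv k l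
  val_inv := by
    ext k l i
    have h := congrFun (congrFun (G i).val_inv k) l
    simp only [Matrix.mul_apply, Fin.sum_univ_two, Matrix.one_apply] at h
    simp only [Matrix.mul_apply, Fin.sum_univ_two, Matrix.one_apply, Matrix.of_apply,
      Pi.add_apply, Pi.mul_apply, h]
    split_ifs <;> rfl
  inv_val := by
    ext k l i
    have h := congrFun (congrFun (G i).inv_val k) l
    simp only [Matrix.mul_apply, Fin.sum_univ_two, Matrix.one_apply] at h
    simp only [Matrix.mul_apply, Fin.sum_univ_two, Matrix.one_apply, Matrix.of_apply,
      Pi.add_apply, Pi.mul_apply, h]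
    split_ifs <;> rfl

theorem piMatrixUnit_val_apply {I : Type*} {R : I → Type*} [∀ i, Ring (R i)]
    (G : ∀ i, (Matrix (Fin 2) (Fin 2) (R i))ˣ) (k l : Fin 2) (i : I) :
    (piMatrixUnit G).val k l i = (G i).val k l :=
  rfl

theorem IsPoint.exists_distant {R : Type*} [Ring R] {p : Submodule R (R × R)}
    (hp : IsPoint R p) : ∃ x, Distant x p := by
  obtain ⟨g, rfl⟩ := hp
  refine ⟨_, ⟨⟨g.val.submatrix (Equiv.swap 0 1) id, g.inv.submatrix id (Equiv.swap 0 1),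
    ?_, ?_⟩, rfl, ?_⟩⟩
  · rw [← Matrix.submatrix_mul _ _ _ _ _ Function.bijective_id, g.val_inv,
      Matrix.submatrix_one_equiv]
  · rw [← Matrix.submatrix_mul _ _ _ _ _ (Equiv.bijective _), g.inv_val, Matrix.submatrix_id_id]
  · simp

theorem Distant.isPoint_left {R : Type*} [Ring R] {p q : Submodule R (R × R)}
    (h : Distant p q) : IsPoint R p :=
  h.imp fun _ hg => hg.1

theorem Distant.component {I : Type*} {R : I → Type*} [∀ i, Ring (R i)]
    {p q : Submodule (Π i, R i) ((Π i, R i) × (Π i, R i))} (h : Distant p q) (i : I) :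
    Distant (component p i) (component q i) := by
  obtain ⟨g, rfl, rfl⟩ := h
  refine ⟨Units.map (Pi.evalRingHom R i).mapMatrix.toMonoidHom g, ?_, ?_⟩
  · rw [component_span_singleton]
    simp
  · rw [component_span_singleton]
    simp

theorem distant_of_component {I : Type*} {R : I → Type*} [∀ i, Ring (R i)]
    {p q : Submodule (Π i, R i) ((Π i, R i) × (Π i, R i))}
    (hp : IsPoint (Π i, R i) p) (hq : IsPoint (Π i, R i) q)
    (h : ∀ i, Distant (component p i) (component q i)) : Distant p q := by
  obtain ⟨g, rfl⟩ := hp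
  obtain ⟨k, rfl⟩ := hq
  choose G hG₀ hG₁ using h
  refine ⟨piMatrixUnit G, span_singleton_eq_of_component_eq fun i => ?_,
    span_singleton_eq_of_component_eq fun i => ?_⟩
  · rw [hG₀ i, component_span_singleton, piMatrixUnit_val_apply, piMatrixUnit_val_apply]
  · rw [hG₁ i, component_span_singleton, piMatrixUnit_val_apply, piMatrixUnit_val_apply]

theorem exists_point_component_eq {I : Type*} {R : I → Type*} [∀ i, Ring (R i)]
    (x : ∀ i, Submodule (R i) (R i × R i)) (hx : ∀ i, IsPoint (R i) (x i)) :
    ∃ p, IsPoint (Π i, R i) p ∧ ∀ i, component p i = x i := by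
  choose G hG using hx
  refine ⟨_, ⟨piMatrixUnit G, rfl⟩, fun i => ?_⟩
  rw [hG i, component_span_singleton, piMatrixUnit_val_apply, piMatrixUnit_val_apply]

/-- For a direct product `R = Π_{i ∈ I} R_i` (`I` non-empty) and points
`p, q` of `ℙ(R)`: `p ∥ q ↔ ∀ i, p_i ∥ q_i`. -/
theorem stmt_12 {I : Type*} [Nonempty I] {R : I → Type*} [∀ i, Ring (R i)]
    (p q : Submodule (Π i, R i) ((Π i, R i) × (Π i, R i)))
    (hp : IsPoint (Π i, R i) p) (hq : IsPoint (Π i, R i) q) :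
    Parallel p q ↔ ∀ i, Parallel (component p i) (component q i) := by
  constructor
  · intro h i x hx
    classical
    obtain ⟨y, hy⟩ := hp.exists_distant
    have hz : ∀ j, Distant (Function.update (component y) i x j) (component p j) := by
      intro j
      obtain rfl | hj := eq_or_ne j i
      · rw [Function.update_self]
        exact hx
      · rw [Function.update_of_ne hj]
        exact hy.component j
    obtain ⟨z, hzp, hzc⟩ := exists_point_component_eq _ fun j => (hz j).isPoint_left
    have hzq : Distant z q := h (distant_of_component hzp hp fun j => (hzc j).symm ▸ hz j)
    have hxq := hzq.component i
    rwa [hzc, Function.update_self] at hxq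
  · intro h x hx
    exact distant_of_component hx.isPoint_left hq fun i => h i (hx.component i)
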